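/- For every n ≥ 1, Σ_{π ∈ B_n} t^{fd(π)} q^{fmaj(π)} = ∏_{i=1}^{n} (1 + t q^i) · Σ_{σ ∈ S_n} t^{des(σ)} q^{maj(σ)}. -/

import Mathlib

open Finset

/-- `π` is an element of the hyperoctahedral group `B_n`: a bijection of `ℤ`
satisfying `π (-a) = -π a` for all `a`, and fixing every `a` with `|a| > n`
(so it restricts to a bijection of `{-n,…,-1,1,…,n}`). -/
def IsSignedPerm (n : ℕ) (π : Equiv.Perm ℤ) : Prop :=
  (∀ a : ℤ, π (-a) = - π a) ∧ ∀ a : ℤ, (n : ℤ) < |a| → π a = a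

/-- The hyperoctahedral group `B_n`, as a set of permutations of `ℤ`. -/
def BSet (n : ℕ) : Set (Equiv.Perm ℤ) := {π | IsSignedPerm n π}

/-- The descent set `Des_A(π) = {i ∈ [n-1] : π(i) > π(i+1)}`. -/
def DesA (n : ℕ) (π : Equiv.Perm ℤ) : Finset ℕ :=
  (Finset.Icc 1 (n - 1)).filter fun i => π ((i : ℤ) + 1) < π (i : ℤ)

/-- `des_A(π)`, the number of descents of the window `π(1),…,π(n)`. -/
def desA (n : ℕ) (π : Equiv.Perm ℤ) : ℕ := (DesA n π).card

/-- `maj_A(π) = Σ_{i : π(i) > π(i+1)} i`. -/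
def majA (n : ℕ) (π : Equiv.Perm ℤ) : ℕ := ∑ i ∈ DesA n π, i

/-- `Neg(π) = {i ∈ [n] : π(i) < 0}`. -/
def NegSet (n : ℕ) (π : Equiv.Perm ℤ) : Finset ℕ :=
  (Finset.Icc 1 n).filter fun i => π (i : ℤ) < 0

/-- `neg(π) = |Neg(π)|`. -/
def negStat (n : ℕ) (π : Equiv.Perm ℤ) : ℕ := (NegSet n π).card

/-- `-Σ_{i ∈ Neg(π)} π(i) = Σ_{i ∈ Neg(π)} |π(i)|`, as a natural number. -/
def negSum (n : ℕ) (π : Equiv.Perm ℤ) : ℕ := ∑ i ∈ NegSet n π, (π (i : ℤ)).natAbs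

/-- `inv(π) = #{(i,j) : 1 ≤ i < j ≤ n, π(i) > π(j)}`. -/
def invStat (n : ℕ) (π : Equiv.Perm ℤ) : ℕ :=
  (((Finset.Icc 1 n) ×ˢ (Finset.Icc 1 n)).filter
    (fun p => p.1 < p.2 ∧ π ((p.2 : ℕ) : ℤ) < π ((p.1 : ℕ) : ℤ))).card

/-- The Coxeter length `ℓ(π) = inv(π) - Σ_{i ∈ Neg(π)} π(i)`. -/
def lenB (n : ℕ) (π : Equiv.Perm ℤ) : ℕ := invStat n π + negSum n π

/-- The negative major index `nmaj(π) = maj_A(π) - Σ_{i ∈ Neg(π)} π(i)`. -/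
def nmaj (n : ℕ) (π : Equiv.Perm ℤ) : ℕ := majA n π + negSum n π

/-- The negative descent number `ndes(π) = des_A(π) + neg(π)`. -/
def ndes (n : ℕ) (π : Equiv.Perm ℤ) : ℕ := desA n π + negStat n π

/-- The flag major index `fmaj(π) = 2 maj_A(π) + neg(π)`. -/
def fmaj (n : ℕ) (π : Equiv.Perm ℤ) : ℕ := 2 * majA n π + negStat n π

/-- The flag descent number `fd(π) = 2 des_A(π) + ε₁(π)`. -/
def fd (n : ℕ) (π : Equiv.Perm ℤ) : ℕ :=
  2 * desA n π + (if π 1 < 0 then 1 else 0)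

/-- The symmetric group `S_n`, embedded in `B_n` as the signed permutations
with all window entries positive. -/
def SnSet (n : ℕ) : Set (Equiv.Perm ℤ) :=
  {π | IsSignedPerm n π ∧ ∀ i ∈ Finset.Icc 1 n, 0 < π (i : ℤ)}

/-- `T = {π ∈ B_n : des_A(π) = 0}`. -/
def TSet (n : ℕ) : Set (Equiv.Perm ℤ) :=
  {π | IsSignedPerm n π ∧ desA n π = 0}

/-- The signed permutation with window `1, …, p, z, p+1, …, |z|-1` (the identity if `|z| ≤ p`).
Right multiplication by it inserts the letter `z` after the first `p` letters of a window. -/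
def insertPerm (z : ℤ) (p : ℕ) : Equiv.Perm ℤ :=
  if h : p < z.natAbs then
    { toFun := fun a =>
        if a.natAbs ≤ p ∨ z.natAbs < a.natAbs then a
        else if a = p + 1 then z
        else if a = -(p + 1) then -z
        else if 0 < a then a - 1 else a + 1
      invFun := fun a =>
        if a.natAbs ≤ p ∨ z.natAbs < a.natAbs then
          if a = z then p + 1 else if a = -z then -(p + 1) else a
        else if a = z then p + 1
        else if a = -z then -(p + 1)
        else if 0 < a then a + 1 else a - 1
      left_inv := by
        intro a
        dsimp only
        split_ifs <;> omega
      right_inv := by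
        intro a
        dsimp only
        split_ifs <;> omega }
  else 1

theorem insertPerm_apply {z : ℤ} {p : ℕ} (h : p < z.natAbs) (a : ℤ) :
    insertPerm z p a = if a.natAbs ≤ p ∨ z.natAbs < a.natAbs then a
        else if a = p + 1 then z
        else if a = -(p + 1) then -z
        else if 0 < a then a - 1 else a + 1 := by
  simp [insertPerm, h]

theorem insertPerm_neg {z : ℤ} {p : ℕ} (h : p < z.natAbs) (a : ℤ) :
    insertPerm z p (-a) = -insertPerm z p a := by
  rw [insertPerm_apply h, insertPerm_apply h]
  split_ifs <;> omega

theorem isSignedPerm_iff {n : ℕ} {π : Equiv.Perm ℤ} :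
    IsSignedPerm n π ↔ (∀ a : ℤ, π (-a) = - π a) ∧ ∀ a : ℤ, n < a.natAbs → π a = a := by
  simp only [IsSignedPerm, Int.abs_eq_natAbs, Nat.cast_lt]

namespace IsSignedPerm

variable {n : ℕ} {π : Equiv.Perm ℤ}

theorem apply_zero (h : IsSignedPerm n π) : π 0 = 0 := by
  have := h.1 0
  simp at this
  omega

theorem apply_eq_self (h : IsSignedPerm n π) {a : ℤ} (ha : n < a.natAbs) : π a = a :=
  (isSignedPerm_iff.1 h).2 a ha

theorem natAbs_apply_le (h : IsSignedPerm n π) {a : ℤ} (ha : a.natAbs ≤ n) :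
    (π a).natAbs ≤ n := by
  by_contra! hlt
  have := π.injective (h.apply_eq_self hlt)
  omega

theorem mul_insertPerm (h : IsSignedPerm n π) {z : ℤ} (hz : z.natAbs = n + 1) {p : ℕ}
    (hp : p ≤ n) : IsSignedPerm (n + 1) (π * insertPerm z p) := by
  rw [isSignedPerm_iff]
  refine ⟨fun a => ?_, fun a ha => ?_⟩
  · rw [Equiv.Perm.mul_apply, insertPerm_neg (by omega), h.1, Equiv.Perm.mul_apply]
  · rw [Equiv.Perm.mul_apply, insertPerm_apply (by omega), if_pos (by omega),
      h.apply_eq_self (by omega)]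

theorem mul_insertPerm_apply_of_le (z : ℤ) (hz : z.natAbs = n + 1) {p : ℕ}
    (hp : p ≤ n) {i : ℕ} (hi : i ≤ p) : (π * insertPerm z p) i = π i := by
  rw [Equiv.Perm.mul_apply, insertPerm_apply (by omega), if_pos (by omega)]

theorem mul_insertPerm_apply_self (h : IsSignedPerm n π) {z : ℤ} (hz : z.natAbs = n + 1) {p : ℕ}
    (hp : p ≤ n) : (π * insertPerm z p) (p + 1 : ℤ) = z := by
  rw [Equiv.Perm.mul_apply, insertPerm_apply (by omega), if_neg (by omega), if_pos rfl,
      h.apply_eq_self (by omega)]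

theorem mul_insertPerm_apply_succ (z : ℤ) (hz : z.natAbs = n + 1) {p : ℕ}
    (hp : p ≤ n) {i : ℕ} (hi : p < i) (hin : i ≤ n) :
    (π * insertPerm z p) (i + 1 : ℤ) = π i := by
  rw [Equiv.Perm.mul_apply, insertPerm_apply (by omega), if_neg (by omega), if_neg (by omega),
    if_neg (by omega), if_pos (by omega), add_sub_cancel_right]

end IsSignedPerm

theorem injOn_mul_insertPerm (n : ℕ) :
    Set.InjOn (fun x : Equiv.Perm ℤ × ℕ × ℤ => x.1 * insertPerm x.2.2 x.2.1)
      {x | IsSignedPerm n x.1 ∧ x.2.1 ≤ n ∧ x.2.2.natAbs = n + 1} := by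
  rintro ⟨π, p, z⟩ ⟨h, hp, hz⟩ ⟨π', p', z'⟩ ⟨h', hp', hz'⟩ heq
  dsimp only at *
  have e1 := h.mul_insertPerm_apply_self hz hp
  have e2 := h'.mul_insertPerm_apply_self hz' hp'
  have hpp : p = p' := by
    rw [heq] at e1
    rcases lt_trichotomy p p' with hlt | rfl | hlt
    · have := IsSignedPerm.mul_insertPerm_apply_of_le (π := π') z' hz' hp' (i := p + 1) hlt
      have h3 := h'.natAbs_apply_le (a := ((p + 1 : ℕ) : ℤ)) (by omega)
      simp only [Nat.cast_add, Nat.cast_one] at this h3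
      omega
    · rfl
    · have := IsSignedPerm.mul_insertPerm_apply_succ (π := π') z' hz' hp' (i := p) hlt hp
      have h3 := h'.natAbs_apply_le (a := (p : ℤ)) (by omega)
      omega
  subst hpp
  rw [heq] at e1
  have hzz : z = z' := e1.symm.trans e2
  subst hzz
  rw [mul_right_cancel heq]

theorem IsSignedPerm.exists_eq_mul_insertPerm {n : ℕ} {σ : Equiv.Perm ℤ}
    (h : IsSignedPerm (n + 1) σ) :
    ∃ π p, IsSignedPerm n π ∧ p ≤ n ∧ (σ (p + 1 : ℤ)).natAbs = n + 1 ∧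
      π * insertPerm (σ (p + 1 : ℤ)) p = σ := by
  obtain ⟨x, hx⟩ := σ.surjective (n + 1)
  have hx0 : x ≠ 0 := by
    rintro rfl
    have := h.apply_zero
    omega
  have hxn : x.natAbs ≤ n + 1 := by
    by_contra! hlt
    have := h.apply_eq_self hlt
    omega
  obtain ⟨p, hp⟩ : ∃ p : ℕ, x.natAbs = p + 1 := ⟨x.natAbs - 1, by omega⟩
  have hz : σ (p + 1 : ℤ) = n + 1 ∧ x = p + 1 ∨ σ (p + 1 : ℤ) = -(n + 1) ∧ x = -(p + 1) := by
    rcases (by omega : x = p + 1 ∨ x = -(p + 1)) with rfl | rfl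
    · exact Or.inl ⟨hx, rfl⟩
    · rw [h.1] at hx
      exact Or.inr ⟨by omega, rfl⟩
  set z := σ (p + 1 : ℤ) with hzdef
  have hpz : p < z.natAbs := by omega
  refine ⟨σ * (insertPerm z p)⁻¹, p, ?_, by omega, by omega, inv_mul_cancel_right _ _⟩
  rw [isSignedPerm_iff]
  refine ⟨fun a => ?_, fun a ha => ?_⟩
  · obtain ⟨b, rfl⟩ := (insertPerm z p).surjective a
    rw [← insertPerm_neg hpz]
    simp [h.1]
  · rw [Equiv.Perm.mul_apply]
    rcases (by omega : n + 1 < a.natAbs ∨ a = z ∨ a = -z) with hlt | rfl | rfl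
    · have : insertPerm z p a = a := by rw [insertPerm_apply hpz, if_pos (by omega)]
      rw [Equiv.Perm.inv_eq_iff_eq.2 this.symm, h.apply_eq_self hlt]
    · have : insertPerm z p (p + 1 : ℤ) = z := by
        rw [insertPerm_apply hpz, if_neg (by omega), if_pos rfl]
      rw [Equiv.Perm.inv_eq_iff_eq.2 this.symm]
    · have : insertPerm z p (-(p + 1 : ℤ)) = -z := by
        rw [insertPerm_neg hpz, insertPerm_apply hpz, if_neg (by omega), if_pos rfl]
      rw [Equiv.Perm.inv_eq_iff_eq.2 this.symm, h.1]

theorem BSet_succ (n : ℕ) :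
    BSet (n + 1) = (fun x : Equiv.Perm ℤ × ℕ × ℤ => x.1 * insertPerm x.2.2 x.2.1) ''
      (BSet n ×ˢ ((range (n + 1) ×ˢ {(n + 1 : ℤ), -(n + 1 : ℤ)} : Finset (ℕ × ℤ)) :
        Set (ℕ × ℤ))) := by
  ext σ
  constructor
  · intro h
    obtain ⟨π, p, hπ, hp, hz, heq⟩ := IsSignedPerm.exists_eq_mul_insertPerm h
    refine ⟨(π, p, _), ⟨hπ, ?_⟩, heq⟩
    simp only [coe_product, coe_range, Set.mem_prod, Set.mem_Iio, coe_insert, coe_singleton,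
      Set.mem_insert_iff, Set.mem_singleton_iff]
    omega
  · rintro ⟨⟨π, p, z⟩, ⟨hπ, h⟩, rfl⟩
    simp only [coe_product, coe_range, Set.mem_prod, Set.mem_Iio, coe_insert, coe_singleton,
      Set.mem_insert_iff, Set.mem_singleton_iff] at h
    dsimp only at hπ ⊢
    exact IsSignedPerm.mul_insertPerm hπ (by omega) (by omega)

theorem SnSet_succ (n : ℕ) :
    SnSet (n + 1) = (fun x : Equiv.Perm ℤ × ℕ × ℤ => x.1 * insertPerm x.2.2 x.2.1) ''
      (SnSet n ×ˢ ((range (n + 1) ×ˢ {(n + 1 : ℤ)} : Finset (ℕ × ℤ)) : Set (ℕ × ℤ))) := by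
  ext σ
  constructor
  · rintro ⟨h, hpos⟩
    obtain ⟨π, p, hπ, hp, hz, heq⟩ := IsSignedPerm.exists_eq_mul_insertPerm h
    have hzpos := hpos (p + 1) (by simp; omega)
    simp only [Nat.cast_add, Nat.cast_one] at hzpos
    refine ⟨(π, p, _), ⟨⟨hπ, fun i hi => ?_⟩, ?_⟩, heq⟩
    · rw [mem_Icc] at hi
      rcases le_or_gt i p with hip | hip
      · rw [← IsSignedPerm.mul_insertPerm_apply_of_le (π := π) _ hz hp hip, heq]
        exact hpos i (by simp; omega)
      · rw [← IsSignedPerm.mul_insertPerm_apply_succ (π := π) _ hz hp hip hi.2, heq]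
        exact_mod_cast hpos (i + 1) (by simp; omega)
    · simp only [coe_product, coe_range, Set.mem_prod, Set.mem_Iio, coe_singleton,
        Set.mem_singleton_iff]
      omega
  · rintro ⟨⟨π, p, z⟩, ⟨⟨hπ, hpos⟩, h⟩, rfl⟩
    simp only [coe_product, coe_range, Set.mem_prod, Set.mem_Iio, coe_singleton,
      Set.mem_singleton_iff] at h
    dsimp only at hπ hpos h ⊢
    obtain ⟨hp, rfl⟩ := h
    have hz : (n + 1 : ℤ).natAbs = n + 1 := by omega
    refine ⟨hπ.mul_insertPerm hz (by omega), fun i hi => ?_⟩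
    rw [mem_Icc] at hi
    rcases lt_trichotomy i (p + 1) with hip | rfl | hip
    · rw [IsSignedPerm.mul_insertPerm_apply_of_le _ hz (by omega) (by omega)]
      exact hpos i (by simp; omega)
    · simp only [Nat.cast_add, Nat.cast_one]
      rw [hπ.mul_insertPerm_apply_self hz (by omega)]
      omega
    · obtain ⟨j, rfl⟩ : ∃ j, i = j + 1 := ⟨i - 1, by omega⟩
      simp only [Nat.cast_add, Nat.cast_one]
      rw [IsSignedPerm.mul_insertPerm_apply_succ _ hz (by omega) (by omega) (by omega)]
      exact hpos j (by simp; omega)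

theorem BSet_zero : BSet 0 = {1} := by
  ext π
  simp only [BSet, Set.mem_ofPred_eq, Set.mem_singleton_iff]
  constructor
  · intro h
    ext a
    rcases eq_or_ne a 0 with rfl | ha
    · exact h.apply_zero
    · exact h.apply_eq_self (by omega)
  · rintro rfl
    simp [IsSignedPerm]

theorem SnSet_subset_BSet (n : ℕ) : SnSet n ⊆ BSet n := fun _ h => h.1

theorem SnSet_zero : SnSet 0 = {1} := by
  rw [← BSet_zero]
  ext π
  simp [SnSet, BSet]

theorem finite_BSet (n : ℕ) : (BSet n).Finite := by
  induction n with
  | zero => simp [BSet_zero]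
  | succ n ih =>
    rw [BSet_succ]
    exact (ih.prod (Finset.finite_toSet _)).image _

theorem finsum_mem_image_mul_insertPerm {M : Type*} [AddCommMonoid M] {n : ℕ}
    {G : Set (Equiv.Perm ℤ)} (hG : G ⊆ BSet n) {Z : Finset ℤ} (hZ : ∀ z ∈ Z, z.natAbs = n + 1)
    (F : Equiv.Perm ℤ → M) :
    ∑ᶠ σ ∈ (fun x : Equiv.Perm ℤ × ℕ × ℤ => x.1 * insertPerm x.2.2 x.2.1) ''
      (G ×ˢ ((range (n + 1) ×ˢ Z : Finset (ℕ × ℤ)) : Set (ℕ × ℤ))), F σ =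
    ∑ᶠ π ∈ G, ∑ p ∈ range (n + 1), ∑ z ∈ Z, F (π * insertPerm z p) := by
  obtain ⟨S, rfl⟩ := ((finite_BSet n).subset hG).exists_finset_coe
  rw [finsum_mem_image, ← coe_product, finsum_mem_coe_finset, finsum_mem_coe_finset, sum_product]
  · exact sum_congr rfl fun π _ => by rw [sum_product]
  · refine (injOn_mul_insertPerm n).mono ?_
    rintro ⟨π, p, z⟩ ⟨h1, h2⟩
    simp only [coe_product, coe_range, Set.mem_prod, Set.mem_Iio, mem_coe] at h2
    exact ⟨hG h1, by dsimp only; omega, hZ z h2.2⟩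

/-- The number of elements of `D` exceeding `p`. -/
def numAbove (D : Finset ℕ) (p : ℕ) : ℕ := #{i ∈ D | p < i}

theorem card_filter_le_eq (D : Finset ℕ) (p : ℕ) :
    #{i ∈ D | p ≤ i} = numAbove D p + if p ∈ D then 1 else 0 := by
  have : {i ∈ D | p ≤ i} = {i ∈ D | p < i} ∪ {i ∈ D | i = p} := by
    ext i; simp only [mem_filter, mem_union]; grind
  rw [this, card_union_of_disjoint, numAbove, filter_eq']
  · split_ifs <;> simp
  · rw [disjoint_filter]; intros; omega

/-- The `q`-analogue of a sum over all gaps of a word with descent set `D`. -/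
theorem one_sub_mul_sum_gaps {R : Type*} [CommRing R] (D : Finset ℕ) (T q : R) {k m : ℕ}
    (hkm : k ≤ m) :
    (1 - q) * ∑ p ∈ Ico k m, (if p ∈ D then 1 else T * q ^ p) * q ^ numAbove D p =
      (1 - T * q ^ m) * q ^ #{i ∈ D | m ≤ i} - (1 - T * q ^ k) * q ^ #{i ∈ D | k ≤ i} := by
  induction m, hkm using Nat.le_induction with
  | base => simp
  | succ m hkm ih =>
    have h2 : #{i ∈ D | m + 1 ≤ i} = numAbove D m := rfl
    rw [sum_Ico_succ_top hkm, mul_add, ih, h2, card_filter_le_eq]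
    split_ifs <;> ring

theorem card_insert_gap {P L U E : Finset ℕ} {p : ℕ} (hP : P = L ∪ E ∪ U.image (· + 1))
    (hL : ∀ i ∈ L, i < p) (hE : ∀ i ∈ E, i = p ∨ i = p + 1) (hU : ∀ i ∈ U, p < i) :
    #P = #L + #E + #U ∧ ∑ i ∈ P, i = ∑ i ∈ L, i + ∑ i ∈ E, i + (∑ i ∈ U, i + #U) := by
  have hinj : Set.InjOn (fun i : ℕ => i + 1) U := fun a _ b _ h => by simpa using h
  have d1 : Disjoint L E := by
    rw [disjoint_left]; intro a h1 h2
    have := hL a h1; have := hE a h2; omega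
  have d2 : Disjoint (L ∪ E) (U.image (· + 1)) := by
    rw [disjoint_left]; intro a h1 h2
    rw [mem_image] at h2
    obtain ⟨b, hb, rfl⟩ := h2
    have := hU b hb
    rcases mem_union.1 h1 with h | h
    · have := hL _ h; omega
    · have := hE _ h; omega
  subst hP
  constructor
  · rw [card_union_of_disjoint d2, card_union_of_disjoint d1, card_image_of_injOn hinj]
  · rw [sum_union d2, sum_union d1, sum_image hinj, sum_add_distrib, card_eq_sum_ones]

theorem card_eq_below_add_above (D : Finset ℕ) (p : ℕ) :
    #D = #{i ∈ D | i < p} + numAbove D p + (if p ∈ D then 1 else 0) ∧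
    ∑ i ∈ D, i = ∑ i ∈ D with i < p, i + ∑ i ∈ D with p < i, i + (if p ∈ D then p else 0) := by
  have hnot : {i ∈ D | ¬ i < p} = {i ∈ D | p < i} ∪ {i ∈ D | i = p} := by
    ext i; simp only [mem_filter, mem_union]; grind
  have hd : Disjoint {i ∈ D | p < i} {i ∈ D | i = p} := by
    rw [disjoint_filter]; intros; omega
  constructor
  · rw [← card_filter_add_card_filter_not (fun i => i < p), hnot, card_union_of_disjoint hd,
      numAbove, filter_eq', add_assoc]
    split_ifs <;> simp
  · rw [← sum_filter_add_sum_filter_not D (fun i => i < p), hnot, sum_union hd, filter_eq',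
      add_assoc]
    split_ifs <;> simp

theorem mem_DesA {n : ℕ} {π : Equiv.Perm ℤ} {i : ℕ} :
    i ∈ DesA n π ↔ (1 ≤ i ∧ i + 1 ≤ n) ∧ π ((i : ℤ) + 1) < π (i : ℤ) := by
  rw [DesA, mem_filter, mem_Icc]
  grind

section Insert

variable {n : ℕ} {π : Equiv.Perm ℤ} {p : ℕ}

theorem IsSignedPerm.DesA_mul_insertPerm (h : IsSignedPerm n π) {z : ℤ} (hz : z.natAbs = n + 1)
    (hp : p ≤ n) : DesA (n + 1) (π * insertPerm z p) =
      {i ∈ DesA n π | i < p} ∪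
      (if 0 < z then if p < n then {p + 1} else ∅ else if 0 < p then {p} else ∅) ∪
      {i ∈ DesA n π | p < i}.image (· + 1) := by
  ext i
  simp only [mem_union, mem_image, mem_filter, mem_DesA]
  have hb : ∀ j : ℕ, j ≤ n → (π j).natAbs ≤ n := fun j hj => h.natAbs_apply_le (by omega)
  have hself := h.mul_insertPerm_apply_self hz hp
  have hle : ∀ j : ℕ, j ≤ p → (π * insertPerm z p) j = π j := fun j hj =>
    mul_insertPerm_apply_of_le z hz hp hj
  have hsucc : ∀ j : ℕ, p < j → j ≤ n → (π * insertPerm z p) (j + 1 : ℤ) = π j :=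
    fun j hj hjn => mul_insertPerm_apply_succ z hz hp hj hjn
  have hE : (i ∈ (if 0 < z then if p < n then ({p + 1} : Finset ℕ) else ∅
      else if 0 < p then {p} else ∅)) ↔ (0 < z ∧ p < n ∧ i = p + 1) ∨
        (¬ 0 < z ∧ 0 < p ∧ i = p) := by
    split_ifs <;> simp [*]
  rw [hE]
  have hU : (∃ a : ℕ, (((1 ≤ a ∧ a + 1 ≤ n) ∧ π ((a : ℤ) + 1) < π a) ∧ p < a) ∧ a + 1 = i) ↔
      (p + 1 < i ∧ i ≤ n ∧ π i < π ((i : ℤ) - 1)) := by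
    constructor
    · rintro ⟨a, ⟨⟨h1, h2⟩, h3⟩, rfl⟩
      refine ⟨by omega, by omega, ?_⟩
      simp only [Nat.cast_add, Nat.cast_one]
      rwa [add_sub_cancel_right]
    · rintro ⟨h1, h2, h3⟩
      obtain ⟨j, rfl⟩ : ∃ j, i = j + 1 := ⟨i - 1, by omega⟩
      simp only [Nat.cast_add, Nat.cast_one] at h3
      rw [add_sub_cancel_right] at h3
      exact ⟨j, ⟨⟨⟨by omega, by omega⟩, h3⟩, by omega⟩, rfl⟩
  rw [hU]
  clear hU hE
  rcases lt_trichotomy i p with hi | rfl | hi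
  · have e1 := hle i hi.le
    have e2 := hle (i + 1) hi
    simp only [Nat.cast_add, Nat.cast_one] at e2
    rw [e1, e2]
    omega
  · have := hb i hp
    rw [hself, hle i le_rfl]
    omega
  · rcases (show p + 1 ≤ i from hi).eq_or_lt with rfl | hi'
    · simp only [Nat.cast_add, Nat.cast_one]
      rw [hself]
      rcases hp.eq_or_lt with rfl | hpn
      · omega
      · have := hb (p + 1) hpn
        have e := hsucc (p + 1) (by omega) hpn
        simp only [Nat.cast_add, Nat.cast_one] at e this
        rw [e, and_true]
        omega
    · obtain ⟨j, rfl⟩ : ∃ j, i = j + 1 := ⟨i - 1, by omega⟩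
      by_cases hjn : j + 1 ≤ n
      · have e1 := hsucc (j + 1) (by omega) hjn
        have e2 := hsucc j (by omega) (by omega)
        simp only [Nat.cast_add, Nat.cast_one] at e1 e2 ⊢
        rw [e1, e2, add_sub_cancel_right]
        omega
      · omega

theorem IsSignedPerm.stats_mul_insertPerm (h : IsSignedPerm n π) {z : ℤ}
    (hz : z.natAbs = n + 1) (hp : p ≤ n) {E : Finset ℕ}
    (hE : E = if 0 < z then if p < n then {p + 1} else ∅ else if 0 < p then {p} else ∅) :
    desA (n + 1) (π * insertPerm z p) + (if p ∈ DesA n π then 1 else 0) = desA n π + #E ∧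
    majA (n + 1) (π * insertPerm z p) + (if p ∈ DesA n π then p else 0) =
      majA n π + numAbove (DesA n π) p + ∑ i ∈ E, i := by
  have key := card_insert_gap (p := p) (h.DesA_mul_insertPerm hz hp)
    (fun i hi => (mem_filter.1 hi).2) (by split_ifs <;> simp) (fun i hi => (mem_filter.1 hi).2)
  obtain ⟨c1, c2⟩ := card_eq_below_add_above (DesA n π) p
  rw [← hE] at key
  rw [desA, desA, majA, majA, key.1, key.2, c1, c2]
  simp only [numAbove]
  constructor <;> ring

theorem notMem_DesA_of_le (h : n ≤ p) : p ∉ DesA n π := by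
  rw [mem_DesA]; omega

theorem zero_notMem_DesA : 0 ∉ DesA n π := by
  rw [mem_DesA]; omega

theorem numAbove_insert_DesA :
    numAbove (insert n (DesA n π)) p = numAbove (DesA n π) p + if p < n then 1 else 0 := by
  rw [numAbove, numAbove, filter_insert]
  split_ifs
  · rw [card_insert_of_notMem]
    exact fun h => notMem_DesA_of_le le_rfl (mem_filter.1 h).1
  · rfl

theorem numAbove_DesA_self : numAbove (DesA n π) n = 0 := by
  rw [numAbove, card_eq_zero, filter_eq_empty_iff]
  intro i hi
  rw [mem_DesA] at hi
  omega

theorem IsSignedPerm.stats_mul_insertPerm_pos (h : IsSignedPerm n π) (hp : p ≤ n) :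
    desA (n + 1) (π * insertPerm (n + 1) p) =
      desA n π + (if p ∈ insert n (DesA n π) then 0 else 1) ∧
    majA (n + 1) (π * insertPerm (n + 1) p) =
      majA n π + numAbove (insert n (DesA n π)) p +
        (if p ∈ insert n (DesA n π) then 0 else p) := by
  have key := h.stats_mul_insertPerm (z := n + 1) (by omega) hp rfl
  rw [if_pos (show (0 : ℤ) < n + 1 by omega)] at key
  rw [numAbove_insert_DesA]
  simp only [mem_insert]
  rcases hp.eq_or_lt with rfl | hlt
  · have := notMem_DesA_of_le (π := π) (le_refl p)
    simpa [this] using key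
  · by_cases hD : p ∈ DesA n π <;> simp [hD, hlt, hlt.ne] at key ⊢ <;> omega

theorem IsSignedPerm.stats_mul_insertPerm_neg (h : IsSignedPerm n π) (hp : p ≤ n) :
    desA (n + 1) (π * insertPerm (-(n + 1)) p) =
      desA n π + (if p = 0 ∨ p ∈ DesA n π then 0 else 1) ∧
    majA (n + 1) (π * insertPerm (-(n + 1)) p) =
      majA n π + numAbove (DesA n π) p + (if p ∈ DesA n π then 0 else p) := by
  have key := h.stats_mul_insertPerm (z := -(n + 1)) (by omega) hp rfl
  rw [if_neg (show ¬ (0 : ℤ) < -(n + 1) by omega)] at key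
  rcases p.eq_zero_or_pos with rfl | hlt
  · have := zero_notMem_DesA (n := n) (π := π)
    simpa [this] using key
  · by_cases hD : p ∈ DesA n π <;> simp [hD, hlt, hlt.ne'] at key ⊢ <;> omega

theorem IsSignedPerm.negStat_mul_insertPerm (h : IsSignedPerm n π) {z : ℤ}
    (hz : z.natAbs = n + 1) (hp : p ≤ n) :
    negStat (n + 1) (π * insertPerm z p) = negStat n π + if z < 0 then 1 else 0 := by
  have hself := h.mul_insertPerm_apply_self hz hp
  have hP : NegSet (n + 1) (π * insertPerm z p) =
      {i ∈ NegSet n π | i < p + 1} ∪ (if z < 0 then {p + 1} else ∅) ∪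
        {i ∈ NegSet n π | p + 1 ≤ i}.image (· + 1) := by
    have hE : ∀ i, (i ∈ (if z < 0 then ({p + 1} : Finset ℕ) else ∅)) ↔ z < 0 ∧ i = p + 1 := by
      intro i; split_ifs <;> simp [*]
    ext i
    simp only [NegSet, mem_union, mem_image, mem_filter, mem_Icc, hE]
    rcases lt_trichotomy i (p + 1) with hi | rfl | hi
    · rw [mul_insertPerm_apply_of_le z hz hp (by omega)]
      grind
    · simp only [Nat.cast_add, Nat.cast_one]
      rw [hself]
      grind
    · obtain ⟨j, rfl⟩ : ∃ j, i = j + 1 := ⟨i - 1, by omega⟩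
      by_cases hj : j ≤ n
      · simp only [Nat.cast_add, Nat.cast_one]
        rw [mul_insertPerm_apply_succ z hz hp (by omega) hj]
        grind
      · grind
  have hinj : Set.InjOn (fun i : ℕ => i + 1) ({i ∈ NegSet n π | p + 1 ≤ i} : Finset ℕ) :=
    fun a _ b _ h => by simpa using h
  have hnot : {i ∈ NegSet n π | p + 1 ≤ i} = {i ∈ NegSet n π | ¬ i < p + 1} := by
    simp only [not_lt]
  rw [negStat, negStat, hP, card_union_of_disjoint, card_union_of_disjoint,
    card_image_of_injOn hinj,
    ← card_filter_add_card_filter_not (s := NegSet n π) (fun i => i < p + 1),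
    hnot]
  · split_ifs <;> simp
    omega
  · rw [disjoint_left]; intro a; split_ifs <;> simp
    omega
  · rw [disjoint_left]; intro a; split_ifs <;> simp <;> grind

theorem IsSignedPerm.mul_insertPerm_apply_one (h : IsSignedPerm n π) {z : ℤ}
    (hz : z.natAbs = n + 1) (hp : p ≤ n) :
    (π * insertPerm z p) 1 = if p = 0 then z else π 1 := by
  split_ifs with h0
  · subst h0
    simpa using h.mul_insertPerm_apply_self hz hp
  · simpa using mul_insertPerm_apply_of_le (π := π) z hz hp (i := 1) (by omega)

end Insert

section Recurrence

variable {R : Type*} [CommRing R] {n : ℕ} {π : Equiv.Perm ℤ}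

theorem card_filter_insert_DesA (hn : n ≠ 0) :
    #{i ∈ insert n (DesA n π) | 1 ≤ i} = desA n π + 1 ∧ #{i ∈ DesA n π | 1 ≤ i} = desA n π := by
  have h1 : {i ∈ DesA n π | 1 ≤ i} = DesA n π :=
    filter_true_of_mem fun i hi => (mem_DesA.1 hi).1.1
  rw [filter_insert, if_pos (by omega), h1,
    card_insert_of_notMem (notMem_DesA_of_le le_rfl)]
  exact ⟨rfl, rfl⟩

theorem card_filter_succ_le :
    #{i ∈ insert n (DesA n π) | n + 1 ≤ i} = 0 ∧ #{i ∈ DesA n π | n + 1 ≤ i} = 0 := by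
  constructor <;>
  · rw [card_eq_zero, filter_eq_empty_iff]
    intro i hi
    simp only [mem_insert, mem_DesA] at hi
    omega

theorem IsSignedPerm.sum_insertions_A (h : IsSignedPerm n π) (t q : R) :
    (1 - q) * ∑ p ∈ range (n + 1), t ^ desA (n + 1) (π * insertPerm (n + 1) p) *
        q ^ majA (n + 1) (π * insertPerm (n + 1) p) =
      (1 - t * q ^ (n + 1)) * (t ^ desA n π * q ^ majA n π) -
        q * (1 - t) * ((t * q) ^ desA n π * q ^ majA n π) := by
  have key := one_sub_mul_sum_gaps (insert n (DesA n π)) t q (Nat.zero_le (n + 1))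
  have hw : ∀ p ∈ range (n + 1), t ^ desA (n + 1) (π * insertPerm (n + 1) p) *
        q ^ majA (n + 1) (π * insertPerm (n + 1) p) = (t ^ desA n π * q ^ majA n π) *
      ((if p ∈ insert n (DesA n π) then 1 else t * q ^ p) *
        q ^ numAbove (insert n (DesA n π)) p) := by
    intro p hp
    rw [mem_range] at hp
    obtain ⟨e1, e2⟩ := h.stats_mul_insertPerm_pos (p := p) (by omega)
    rw [e1, e2]
    split_ifs <;> ring
  have hc : #{i ∈ insert n (DesA n π) | 0 ≤ i} = desA n π + 1 := by
    rw [filter_true_of_mem (by simp), card_insert_of_notMem (notMem_DesA_of_le le_rfl), desA]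
  rw [sum_congr rfl hw, ← mul_sum, mul_left_comm, range_eq_Ico, key, hc, card_filter_succ_le.1]
  ring

theorem IsSignedPerm.sum_insertions_B (h : IsSignedPerm n π) (t q : R) :
    (1 - q ^ 2) * ∑ p ∈ range (n + 1),
        (t ^ fd (n + 1) (π * insertPerm (n + 1) p) *
          q ^ fmaj (n + 1) (π * insertPerm (n + 1) p) +
        t ^ fd (n + 1) (π * insertPerm (-(n + 1)) p) *
          q ^ fmaj (n + 1) (π * insertPerm (-(n + 1)) p)) =
      (1 + q) * ((1 - t ^ 2 * q ^ (2 * (n + 1))) * (t ^ fd n π * q ^ fmaj n π) -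
        q * (1 - t) * (1 + t * q) * ((t * q) ^ fd n π * q ^ fmaj n π)) := by
  have zpos : (n + 1 : ℤ).natAbs = n + 1 := by omega
  have zneg : (-(n + 1) : ℤ).natAbs = n + 1 := by omega
  have npos : ¬ (n + 1 : ℤ) < 0 := by omega
  have nneg : (-(n + 1) : ℤ) < 0 := by omega
  rcases Nat.eq_zero_or_pos n with rfl | hn
  · obtain rfl : π = 1 := by
      have : π ∈ BSet 0 := h
      rwa [BSet_zero] at this
    have p1 := h.stats_mul_insertPerm_pos (p := 0) le_rfl
    have m1 := h.stats_mul_insertPerm_neg (p := 0) le_rfl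
    have p2 := h.negStat_mul_insertPerm (p := 0) zpos le_rfl
    have m2 := h.negStat_mul_insertPerm (p := 0) zneg le_rfl
    have p3 := h.mul_insertPerm_apply_one (p := 0) zpos le_rfl
    have m3 := h.mul_insertPerm_apply_one (p := 0) zneg le_rfl
    have d0 : DesA 0 (1 : Equiv.Perm ℤ) = ∅ := by simp [DesA]
    have n0 : NegSet 0 (1 : Equiv.Perm ℤ) = ∅ := by simp [NegSet]
    rw [sum_range_one]
    unfold fd fmaj
    rw [p1.1, p1.2, m1.1, m1.2, p2, m2, p3, m3]
    simp [desA, majA, negStat, d0, n0, numAbove, filter_singleton]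
    ring
  have key1 := one_sub_mul_sum_gaps (insert n (DesA n π)) (t ^ 2) (q ^ 2)
    (Nat.le_add_left 1 n)
  have key2 := one_sub_mul_sum_gaps (DesA n π) (t ^ 2) (q ^ 2) (Nat.le_add_left 1 n)
  rw [(card_filter_insert_DesA hn.ne').1, card_filter_succ_le.1] at key1
  rw [(card_filter_insert_DesA hn.ne').2, card_filter_succ_le.2] at key2
  have hw : ∀ p ∈ Ico 1 (n + 1),
      (t ^ fd (n + 1) (π * insertPerm (n + 1) p) *
          q ^ fmaj (n + 1) (π * insertPerm (n + 1) p) +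
        t ^ fd (n + 1) (π * insertPerm (-(n + 1)) p) *
          q ^ fmaj (n + 1) (π * insertPerm (-(n + 1)) p)) =
      (t ^ fd n π * q ^ fmaj n π) *
        ((if p ∈ insert n (DesA n π) then 1 else t ^ 2 * (q ^ 2) ^ p) *
          (q ^ 2) ^ numAbove (insert n (DesA n π)) p) +
      (t ^ fd n π * q ^ fmaj n π) * q *
        ((if p ∈ DesA n π then 1 else t ^ 2 * (q ^ 2) ^ p) *
          (q ^ 2) ^ numAbove (DesA n π) p) := by
    intro p hp
    rw [mem_Ico] at hp
    have hp' : p ≤ n := by omega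
    have hp0 : p ≠ 0 := by omega
    obtain ⟨p1, p2⟩ := h.stats_mul_insertPerm_pos hp'
    obtain ⟨m1, m2⟩ := h.stats_mul_insertPerm_neg hp'
    have p3 := h.negStat_mul_insertPerm zpos hp'
    have m3 := h.negStat_mul_insertPerm zneg hp'
    have p4 := h.mul_insertPerm_apply_one zpos hp'
    have m4 := h.mul_insertPerm_apply_one zneg hp'
    rw [if_neg hp0] at p4 m4
    rw [if_neg npos] at p3
    rw [if_pos nneg] at m3
    simp only [hp0, false_or] at m1
    unfold fd fmaj
    rw [p1, p2, p3, p4, m1, m2, m3, m4]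
    congr 1
    · split_ifs <;> ring
    · split_ifs <;> ring
  have h0 : numAbove (DesA n π) 0 = desA n π := (card_filter_insert_DesA hn.ne').2
  rw [range_eq_Ico, sum_eq_sum_Ico_succ_bot (by omega), zero_add, sum_congr rfl hw,
    sum_add_distrib, ← mul_sum, ← mul_sum]
  obtain ⟨p1, p2⟩ := h.stats_mul_insertPerm_pos (Nat.zero_le n)
  obtain ⟨m1, m2⟩ := h.stats_mul_insertPerm_neg (Nat.zero_le n)
  have p3 := h.negStat_mul_insertPerm zpos (Nat.zero_le n)
  have m3 := h.negStat_mul_insertPerm zneg (Nat.zero_le n)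
  have p4 := h.mul_insertPerm_apply_one zpos (Nat.zero_le n)
  have m4 := h.mul_insertPerm_apply_one zneg (Nat.zero_le n)
  have hmem : 0 ∉ insert n (DesA n π) := by
    simp only [mem_insert, zero_notMem_DesA, or_false]
    omega
  rw [if_pos rfl] at p4 m4
  rw [if_neg npos] at p3
  rw [if_pos nneg] at m3
  rw [if_neg hmem] at p1 p2
  rw [numAbove_insert_DesA, if_pos hn, h0] at p2
  rw [if_pos (Or.inl rfl)] at m1
  rw [if_neg zero_notMem_DesA, h0] at m2
  unfold fd fmaj
  rw [p1, p2, p3, p4, m1, m2, m3, m4, if_neg npos, if_pos nneg]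
  unfold fd fmaj at *
  split_ifs
  · linear_combination (t ^ (2 * desA n π + 1) * q ^ (2 * majA n π + negStat n π)) *
      (key1 + q * key2)
  · linear_combination (t ^ (2 * desA n π) * q ^ (2 * majA n π + negStat n π)) *
      (key1 + q * key2)

end Recurrence

theorem finsum_BSet_eq {R : Type*} [CommRing R] [IsDomain R] {q : R} (hq : 1 - q ^ 2 ≠ 0)
    (n : ℕ) (t : R) :
    ∑ᶠ π ∈ BSet n, t ^ fd n π * q ^ fmaj n π =
      (∏ i ∈ Icc 1 n, (1 + t * q ^ i)) * ∑ᶠ σ ∈ SnSet n, t ^ desA n σ * q ^ majA n σ := by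
  induction n generalizing t with
  | zero => simp [BSet_zero, SnSet_zero, fd, fmaj, desA, majA, negStat, DesA, NegSet]
  | succ n ih =>
    apply mul_left_cancel₀ hq
    have hne : (n + 1 : ℤ) ≠ -(n + 1) := by omega
    have hfinB := finite_BSet n
    have hfinS := hfinB.subset (SnSet_subset_BSet n)
    have hB : (1 - q ^ 2) * ∑ᶠ π ∈ BSet (n + 1), t ^ fd (n + 1) π * q ^ fmaj (n + 1) π =
        (1 + q) * ((1 - t ^ 2 * q ^ (2 * (n + 1))) *
            ∑ᶠ π ∈ BSet n, t ^ fd n π * q ^ fmaj n π -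
          q * (1 - t) * (1 + t * q) *
            ∑ᶠ π ∈ BSet n, (t * q) ^ fd n π * q ^ fmaj n π) := by
      rw [BSet_succ, finsum_mem_image_mul_insertPerm subset_rfl (by simp; omega)]
      obtain ⟨S, hS⟩ := hfinB.exists_finset_coe
      rw [← hS]
      simp only [finsum_mem_coe_finset]
      rw [mul_sum, mul_sum, mul_sum, ← sum_sub_distrib, mul_sum]
      refine sum_congr rfl fun π hπ => ?_
      have h : IsSignedPerm n π := by
        have : π ∈ BSet n := hS ▸ hπ
        exact this
      simp only [sum_pair hne]
      exact h.sum_insertions_B t q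
    have hA : (1 - q) * ∑ᶠ π ∈ SnSet (n + 1), t ^ desA (n + 1) π * q ^ majA (n + 1) π =
        (1 - t * q ^ (n + 1)) * ∑ᶠ π ∈ SnSet n, t ^ desA n π * q ^ majA n π -
          q * (1 - t) * ∑ᶠ π ∈ SnSet n, (t * q) ^ desA n π * q ^ majA n π := by
      rw [SnSet_succ, finsum_mem_image_mul_insertPerm (SnSet_subset_BSet n) (by simp; omega)]
      obtain ⟨S, hS⟩ := hfinS.exists_finset_coe
      rw [← hS]
      simp only [finsum_mem_coe_finset, mul_sum, ← sum_sub_distrib]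
      refine sum_congr rfl fun π hπ => ?_
      have h : IsSignedPerm n π := by
        have : π ∈ SnSet n := hS ▸ hπ
        exact this.1
      simp only [sum_singleton, ← mul_sum]
      exact h.sum_insertions_A t q
    have hprod : (1 + t * q) * ∏ i ∈ Icc 1 n, (1 + t * q * q ^ i) =
        (∏ i ∈ Icc 1 n, (1 + t * q ^ i)) * (1 + t * q ^ (n + 1)) := by
      clear ih hB hA hfinB hfinS hne
      induction n with
      | zero => simp
      | succ n ih =>
        rw [prod_Icc_succ_top (by omega), prod_Icc_succ_top (by omega), ← mul_assoc, ih]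
        ring
    rw [hB, ih, ih, prod_Icc_succ_top (by omega)]
    linear_combination (-(1 + q) * q * (1 - t) *
      ∑ᶠ π ∈ SnSet n, (t * q) ^ desA n π * q ^ majA n π) * hprod -
      (1 + q) * (∏ i ∈ Icc 1 n, (1 + t * q ^ i)) * (1 + t * q ^ (n + 1)) * hA

theorem stmt_16 (n : ℕ) (hn : 1 ≤ n) :
    (∑ᶠ π ∈ BSet n, (MvPolynomial.X 0 : MvPolynomial (Fin 2) ℤ) ^ fd n π *
        MvPolynomial.X 1 ^ fmaj n π) =
    (∏ i ∈ Finset.Icc 1 n, (1 + MvPolynomial.X 0 * MvPolynomial.X 1 ^ i)) *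
    ∑ᶠ σ ∈ SnSet n, (MvPolynomial.X 0 : MvPolynomial (Fin 2) ℤ) ^ desA n σ *
        MvPolynomial.X 1 ^ majA n σ := by
  refine finsum_BSet_eq (fun h => ?_) n _
  simpa using congrArg (MvPolynomial.eval 0) h
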